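/- Let s be a sequence such that s_i · s_i = 1 for every i (each s_i is an involution), let γ ∈ Γ(s) and λ ∈ Γ(s^{(γ)}). Then γ∘λ ∈ Γ(s) and γ⁻¹ ∈ Γ(s^{(γ)}). -/

import Mathlib

/-- The prefix product `γ^(j) = γ₁ ⋯ γⱼ` of the first `j` entries of a sequence. -/
def prefProd {W : Type*} [Group W] {n : ℕ} (γ : Fin n → W) (j : ℕ) : W :=
  ((List.ofFn γ).take j).prod

/-- `γ ∈ Γ(s)`: a generalized combinatorial gallery for the sequence `s`. -/
def IsGallery {W : Type*} [Group W] {n : ℕ} (s γ : Fin n → W) : Prop :=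
  ∀ i, γ i = 1 ∨ γ i = s i

/-- The sequence `s^{(γ)}` defined by `s^{(γ)}ᵢ = γ^(i) · sᵢ · (γ^(i))⁻¹`. -/
def conjSeq {W : Type*} [Group W] {n : ℕ} (s γ : Fin n → W) : Fin n → W :=
  fun i => prefProd γ (i.val + 1) * s i * (prefProd γ (i.val + 1))⁻¹

/-- The composition `γ∘λ`, given by `(γ∘λ)ᵢ = (γ^(i−1))⁻¹ · λᵢ · γ^(i)`. -/
def compGal {W : Type*} [Group W] {n : ℕ} (γ lam : Fin n → W) : Fin n → W :=
  fun i => (prefProd γ i.val)⁻¹ * lam i * prefProd γ (i.val + 1)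

/-- The constant sequence `ε` with all entries `1`. -/
def epsGal {W : Type*} [Group W] (n : ℕ) : Fin n → W := fun _ => 1

/-- The inverse sequence `γ⁻¹`, given by `(γ⁻¹)ᵢ = γ^(i−1) · (γ^(i))⁻¹`. -/
def invGal {W : Type*} [Group W] {n : ℕ} (γ : Fin n → W) : Fin n → W :=
  fun i => prefProd γ i.val * (prefProd γ (i.val + 1))⁻¹

theorem prefProd_succ {W : Type*} [Group W] {n : ℕ} (γ : Fin n → W) (i : Fin n) :
    prefProd γ (i.val + 1) = prefProd γ i.val * γ i := by
  have hi : i.val < (List.ofFn γ).length := by simp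
  simp [prefProd, List.prod_take_succ _ _ hi]

/-- Let `s` be a sequence such that `sᵢ · sᵢ = 1` for every `i`,
let `γ ∈ Γ(s)` and `λ ∈ Γ(s^{(γ)})`. Then `γ∘λ ∈ Γ(s)` and `γ⁻¹ ∈ Γ(s^{(γ)})`. -/
theorem statement8 {W : Type*} [Group W] {n : ℕ} (s γ lam : Fin n → W)
    (hs : ∀ i, s i * s i = 1)
    (hγ : IsGallery s γ) (hlam : IsGallery (conjSeq s γ) lam) :
    IsGallery s (compGal γ lam) ∧ IsGallery (conjSeq s γ) (invGal γ) := by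
  refine ⟨fun i => ?_, fun i => ?_⟩
  · rcases hlam i with h | h
    · simpa [compGal, h, prefProd_succ] using hγ i
    · have hcomp : compGal γ lam i = γ i * s i := by
        simp [compGal, h, conjSeq, prefProd_succ, mul_assoc]
      rcases hγ i with hg | hg <;> simp [hcomp, hg, hs]
  · rcases hγ i with hg | hg
    · left
      simp [invGal, prefProd_succ, hg]
    · right
      simpa [invGal, conjSeq, prefProd_succ, hg, mul_assoc] using
        inv_eq_of_mul_eq_one_left (hs i)
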